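/- Let ℏ > 0 and c > 0 be fixed. Then there is a constant c_ℏ > 0, depending only on η, c and ℏ, such that for every c-admissible positive harmonic function H on S' and every s > 0 one has ∫_{l ≥ ℏs} H(−η̄ b^{-1} s + l) dl ≤ c_ℏ and ∫_{l ≥ ℏs} H(b^{-1} s − η̄ l) dl ≤ c_ℏ. Moreover, for each fixed such H, both integrals tend to 0 as s → ∞. -/

import Mathlib

open MeasureTheory Filter Set
open scoped ENNReal Topology

noncomputable section

/-- `η = a + ib`. -/
def etaC (a b : ℝ) : ℂ := (a : ℂ) + (b : ℂ) * Complex.I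

/-- The open sector `S = {u+iv : v > 0, bu + av > 0}`. -/
def sectorS (a b : ℝ) : Set ℂ := {z : ℂ | 0 < z.im ∧ 0 < b * z.re + a * z.im}

/-- The larger sector `S' = {u+iv : v > -log 3, bu + av > -log 3}`. -/
def sectorS' (a b : ℝ) : Set ℂ :=
  {z : ℂ | -Real.log 3 < z.im ∧ -Real.log 3 < b * z.re + a * z.im}

/-- A real-valued function on `ℂ` is harmonic on a set: it is `C²` there and its Laplacian
(the sum of the second derivatives in the directions `1` and `i`) vanishes. -/
def HarmonicOnSet (f : ℂ → ℝ) (U : Set ℂ) : Prop :=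
  ContDiffOn ℝ 2 f U ∧
    ∀ z ∈ U, (iteratedFDeriv ℝ 2 f z) ![1, 1] + (iteratedFDeriv ℝ 2 f z) ![Complex.I, Complex.I] = 0

/-- A positive harmonic function on the sector `S'`. -/
def PosHarmonic (a b : ℝ) (H : ℂ → ℝ) : Prop :=
  (∀ z ∈ sectorS' a b, 0 < H z) ∧ HarmonicOnSet H (sectorS' a b)

/-- The exponent `γ = π/θ₀`, where `θ₀ = arg(-η̄) ∈ (0,π)` is the opening angle of `S`. -/
def gammaExp (a b : ℝ) : ℝ := Real.pi / Complex.arg (((-a : ℝ) : ℂ) + (b : ℂ) * Complex.I)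

/-- `c`-admissibility of a function `H` on `S'`: there is `H̃` with `H̃ ∘ Φ = H` on `S`
(where `Φ(ζ) = ζ^γ`), continuous on the closed upper half-plane, bounded by `c` on `ℝ`,
with `∫_ℝ H̃(t)|t|^{-1+1/γ} dt ≤ c`, and satisfying the Poisson formula. -/
def Admissible (a b c : ℝ) (H : ℂ → ℝ) : Prop :=
  ∃ Ht : ℂ → ℝ,
    ContinuousOn Ht {z : ℂ | 0 ≤ z.im} ∧
    (∀ ζ ∈ sectorS a b, Ht (ζ ^ ((gammaExp a b : ℝ) : ℂ)) = H ζ) ∧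
    (∀ t : ℝ, Ht (t : ℂ) ≤ c) ∧
    Integrable (fun t : ℝ => Ht (t : ℂ) * |t| ^ (-1 + 1 / gammaExp a b)) ∧
    (∫ t : ℝ, Ht (t : ℂ) * |t| ^ (-1 + 1 / gammaExp a b)) ≤ c ∧
    (∀ U V : ℝ, 0 < V →
      Ht ((U : ℂ) + (V : ℂ) * Complex.I) =
        (1 / Real.pi) * ∫ t : ℝ, Ht (t : ℂ) * (V / (V ^ 2 + (t - U) ^ 2)))

/-- The point `-η̄ b⁻¹ s + l` on the half-line `Λ_{1,s}`. -/
def lam1pt (a b s l : ℝ) : ℂ :=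
  -(starRingEnd ℂ (etaC a b)) * ((s / b : ℝ) : ℂ) + (l : ℂ)

/-- The point `b⁻¹ s - η̄ l` on the half-line `Λ_{2,s}`. -/
def lam2pt (a b s l : ℝ) : ℂ :=
  ((s / b : ℝ) : ℂ) - (starRingEnd ℂ (etaC a b)) * (l : ℂ)

lemma rpow_law_of_cosines_lower {p x y u : ℝ} (hp : 0 < p) (hy : 0 ≤ y) (hyx : y ≤ x)
    (hx : 0 < x) (hu : 0 ≤ u) (hu2 : u ≤ 2) :
    (1 / 2) ^ p / 16 * (x ^ p) ^ 2 * ((x - y) ^ 2 + 2 * x * y * u) ≤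
      (x ^ p * x - y ^ p * y) ^ 2 + 2 * (x ^ p * x) * (y ^ p * y) * u := by
  have hX : 0 < x ^ p := Real.rpow_pos_of_pos hx p
  have hq : 0 ≤ y ^ p := Real.rpow_nonneg hy p
  have hqX : y ^ p ≤ x ^ p := Real.rpow_le_rpow hy hyx hp.le
  have hd0 : (0 : ℝ) < (1 / 2) ^ p := by positivity
  have hd1 : ((1 : ℝ) / 2) ^ p ≤ 1 :=
    Real.rpow_le_one (by norm_num) (by norm_num) hp.le
  have hhalf : x / 2 ≤ y → (1 / 2) ^ p * x ^ p ≤ y ^ p := by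
    intro h
    rw [← Real.mul_rpow (by norm_num) hx.le]
    exact Real.rpow_le_rpow (by positivity) (by linarith) hp.le
  generalize x ^ p = X at *
  generalize y ^ p = q at *
  generalize ((1 : ℝ) / 2) ^ p = d at *
  have hsub : (x - y) * X ≤ X * x - q * y := by nlinarith
  have hsq : ((x - y) * X) ^ 2 ≤ (X * x - q * y) ^ 2 :=
    pow_le_pow_left₀ (mul_nonneg (by linarith) hX.le) hsub 2
  have hxy : 0 ≤ x * y * u := by positivity
  rcases le_total (x / 2) y with h | h
  · have h1 := mul_le_mul_of_nonneg_left (hhalf h) (mul_nonneg hxy hX.le)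
    have h2 : d / 16 * X ^ 2 * ((x - y) ^ 2) ≤ ((x - y) * X) ^ 2 := by
      rw [mul_pow]
      nlinarith [mul_nonneg (sq_nonneg (x - y)) (sq_nonneg X)]
    have h3 : 0 ≤ d * (x * y * u) * X ^ 2 := by positivity
    nlinarith
  · have h1 : (x - y) ^ 2 + 2 * x * y * u ≤ 4 * x ^ 2 := by nlinarith [mul_nonneg hx.le hy]
    have h2 : x ^ 2 / 4 ≤ (x - y) ^ 2 := by nlinarith
    have h3 : 0 ≤ 2 * (X * x) * (q * y) * u := by positivity
    have h4 : d / 16 * X ^ 2 * ((x - y) ^ 2 + 2 * x * y * u) ≤ 1 / 16 * X ^ 2 * (4 * x ^ 2) := by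
      gcongr
    have h5 := mul_le_mul_of_nonneg_left h2 (sq_nonneg X)
    nlinarith

lemma mul_le_sin_of_mem_Icc {θ φ : ℝ} (hθ0 : 0 < θ) (hθ : θ < Real.pi) (hφ0 : 0 ≤ φ)
    (hφ : φ ≤ θ) : Real.sin θ / θ * φ ≤ Real.sin φ := by
  have h := strictConcaveOn_sin_Icc.concaveOn.2
    (⟨le_rfl, Real.pi_pos.le⟩ : (0 : ℝ) ∈ Set.Icc 0 Real.pi)
    (⟨hθ0.le, hθ.le⟩ : θ ∈ Set.Icc 0 Real.pi)
    (sub_nonneg.2 ((div_le_one hθ0).2 hφ)) (div_nonneg hφ0 hθ0.le) (sub_add_cancel 1 (φ / θ))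
  simp only [smul_eq_mul, Real.sin_zero, mul_zero, zero_add] at h
  rw [div_mul_cancel₀ _ hθ0.ne'] at h
  calc _ = φ / θ * Real.sin θ := by ring
    _ ≤ _ := h

lemma sq_le_one_add_cos {θ φ κ : ℝ} (hθ0 : 0 < θ) (hθ : θ < Real.pi) (hφ0 : 0 < φ)
    (hφ : φ < θ) (hκ : 0 < κ) (hs : κ ≤ Real.sin (θ - φ)) :
    κ ^ 2 / 2 ≤ 1 + Real.cos (φ * (Real.pi / θ)) := by
  have hpi := Real.pi_pos
  set ψ := φ * (Real.pi / θ) with hψ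
  have hπψ : Real.pi - ψ = (θ - φ) * (Real.pi / θ) := by rw [hψ]; field_simp
  have hγ : 1 ≤ Real.pi / θ := by rw [le_div_iff₀ hθ0]; linarith
  have h1 : θ - φ ≤ Real.pi - ψ := by rw [hπψ]; nlinarith
  have hψ0 : 0 < ψ := by positivity
  have h2 : Real.sin ((θ - φ) / 2) ≤ Real.cos (ψ / 2) := by
    rw [← Real.sin_pi_div_two_sub]
    exact Real.sin_le_sin_of_le_of_le_pi_div_two (by linarith) (by linarith) (by linarith)
  have h3 : Real.sin (θ - φ) = 2 * Real.sin ((θ - φ) / 2) * Real.cos ((θ - φ) / 2) := by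
    rw [← Real.sin_two_mul]; congr 1; ring
  have h4 : 0 < Real.sin ((θ - φ) / 2) :=
    Real.sin_pos_of_pos_of_lt_pi (by linarith) (by linarith)
  have h5 : κ / 2 ≤ Real.sin ((θ - φ) / 2) := by
    nlinarith [Real.cos_le_one ((θ - φ) / 2)]
  have h6 : Real.cos ψ = 2 * Real.cos (ψ / 2) ^ 2 - 1 := by
    rw [← Real.cos_two_mul]; congr 1; ring
  nlinarith

/-- Comparison of the Poisson kernel of the half-plane at `(r e^{iφ})^{π/θ}` with that of the
half-plane at `r e^{iφ}`, uniformly away from the edge `φ = θ` of the sector. -/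
lemma exists_poisson_rpow_le {θ κ : ℝ} (hθ0 : 0 < θ) (hθ : θ < Real.pi) (hκ : 0 < κ) :
    ∃ C : ℝ, 0 < C ∧ ∀ r φ t : ℝ, 0 < r → 0 < φ → φ < θ → κ ≤ Real.sin (θ - φ) →
      r ^ (Real.pi / θ) * Real.sin (φ * (Real.pi / θ)) /
          ((r ^ (Real.pi / θ) * Real.sin (φ * (Real.pi / θ))) ^ 2 +
            (t - r ^ (Real.pi / θ) * Real.cos (φ * (Real.pi / θ))) ^ 2) ≤
        C * (max r (|t| ^ (1 / (Real.pi / θ)))) ^ (1 - Real.pi / θ) *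
          (r * Real.sin φ /
            ((r * Real.sin φ) ^ 2 + (r * Real.cos φ - |t| ^ (1 / (Real.pi / θ))) ^ 2)) := by
  have hpi := Real.pi_pos
  set γ := Real.pi / θ with hγdef
  have hγ : 1 < γ := by rw [hγdef, lt_div_iff₀ hθ0]; linarith
  have hsθ : 0 < Real.sin θ := Real.sin_pos_of_pos_of_lt_pi hθ0 hθ
  set C₁ := γ / (Real.sin θ / θ) with hC₁
  have hC₁0 : 0 < C₁ := by positivity
  set c₂ := min ((1 / 2) ^ (γ - 1) / 16) (κ ^ 2 / 16) with hc₂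
  have hc₂0 : 0 < c₂ := by rw [hc₂]; positivity
  refine ⟨C₁ / c₂, by positivity, fun r φ t hr hφ0 hφ hs => ?_⟩
  set τ := |t| ^ (1 / γ) with hτ
  have hτ0 : 0 ≤ τ := by positivity
  set M := max r τ with hM
  have hM0 : 0 < M := lt_max_of_lt_left hr
  have hp : 0 < γ - 1 := by linarith
  have hpow : ∀ x : ℝ, 0 ≤ x → x ^ γ = x ^ (γ - 1) * x := by
    intro x hx
    rcases hx.eq_or_lt with rfl | hx
    · rw [Real.zero_rpow (by linarith)]; simp
    · rw [Real.rpow_sub_one hx.ne']; field_simp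
  have ht : |t| = τ ^ γ := by
    rw [hτ, ← Real.rpow_mul (abs_nonneg t), one_div, inv_mul_cancel₀ (by linarith), Real.rpow_one]
  set ψ := φ * γ with hψ
  have hψ0 : 0 < ψ := by positivity
  have hψπ : ψ < Real.pi := by
    calc ψ < θ * γ := by rw [hψ]; gcongr
      _ = Real.pi := by rw [hγdef]; field_simp
  have hφψ : φ ≤ ψ := by nlinarith
  have hcos : Real.cos ψ ≤ Real.cos φ :=
    Real.cos_le_cos_of_nonneg_of_le_pi hφ0.le hψπ.le hφψ
  have hsφ : 0 < Real.sin φ := Real.sin_pos_of_pos_of_lt_pi hφ0 (by linarith)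
  have hsψ : 0 < Real.sin ψ := Real.sin_pos_of_pos_of_lt_pi hψ0 hψπ
  set E := (r * Real.sin φ) ^ 2 + (r * Real.cos φ - τ) ^ 2 with hE
  have hE0 : 0 < E := by positivity
  have hE' : E = (r - τ) ^ 2 + 2 * r * τ * (1 - Real.cos φ) := by
    rw [hE, mul_pow, Real.sin_sq]; ring
  have hnum : r ^ γ * Real.sin ψ ≤ C₁ * M ^ (γ - 1) * (r * Real.sin φ) := by
    have h1 : Real.sin ψ ≤ C₁ * Real.sin φ := by
      have h := mul_le_sin_of_mem_Icc hθ0 hθ hφ0.le hφ.le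
      calc Real.sin ψ ≤ ψ := Real.sin_le hψ0.le
        _ = C₁ * (Real.sin θ / θ * φ) := by rw [hC₁, hψ]; field_simp
        _ ≤ _ := by gcongr
    have h2 : r ^ (γ - 1) ≤ M ^ (γ - 1) :=
      Real.rpow_le_rpow hr.le (le_max_left _ _) hp.le
    rw [hpow r hr.le]
    calc r ^ (γ - 1) * r * Real.sin ψ ≤ M ^ (γ - 1) * r * (C₁ * Real.sin φ) := by gcongr
      _ = _ := by ring
  have hden : c₂ * (M ^ (γ - 1)) ^ 2 * E ≤
      (r ^ γ * Real.sin ψ) ^ 2 + (t - r ^ γ * Real.cos ψ) ^ 2 := by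
    have hrγ : 0 < r ^ γ := by positivity
    have hτγ : 0 ≤ τ ^ γ := by positivity
    rcases le_total 0 t with h | h
    · rw [abs_of_nonneg h] at ht
      have hD : (r ^ γ - τ ^ γ) ^ 2 + 2 * (r ^ γ) * (τ ^ γ) * (1 - Real.cos φ) ≤
          (r ^ γ * Real.sin ψ) ^ 2 + (t - r ^ γ * Real.cos ψ) ^ 2 := by
        rw [ht, mul_pow, Real.sin_sq]
        linear_combination 2 * mul_le_mul_of_nonneg_left hcos (mul_nonneg hrγ.le hτγ)
      refine le_trans ?_ hD
      have hc : c₂ * (M ^ (γ - 1)) ^ 2 * E ≤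
          (1 / 2) ^ (γ - 1) / 16 * (M ^ (γ - 1)) ^ 2 * E := by
        gcongr; exact min_le_left _ _
      refine hc.trans ?_
      rw [hE', hpow r hr.le, hpow τ hτ0]
      have hu : 0 ≤ 1 - Real.cos φ := by linarith [Real.cos_le_one φ]
      have hu2 : 1 - Real.cos φ ≤ 2 := by linarith [Real.neg_one_le_cos φ]
      rcases le_total τ r with h' | h'
      · rw [hM, max_eq_left h']
        exact rpow_law_of_cosines_lower hp hτ0 h' hr hu hu2
      · rw [hM, max_eq_right h']
        have := rpow_law_of_cosines_lower hp hr.le h' (hr.trans_le h') hu hu2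
        refine le_trans (le_of_eq ?_) (this.trans_eq ?_) <;> ring
    · rw [abs_of_nonpos h] at ht
      have ht' : t = -τ ^ γ := by linarith
      have h1 := sq_le_one_add_cos hθ0 hθ hφ0 hφ hκ hs
      rw [← hγdef, ← hψ] at h1
      have hD : κ ^ 2 / 4 * (r ^ γ + τ ^ γ) ^ 2 ≤
          (r ^ γ * Real.sin ψ) ^ 2 + (t - r ^ γ * Real.cos ψ) ^ 2 := by
        rw [ht', mul_pow, Real.sin_sq]
        have h2 := mul_le_mul_of_nonneg_left h1 (sq_nonneg (r ^ γ + τ ^ γ))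
        have h3 := mul_nonneg (sub_nonneg.2 (Real.cos_le_one ψ)) (sq_nonneg (r ^ γ - τ ^ γ))
        linear_combination (1 / 2) * h2 + (1 / 2) * h3
      refine le_trans ?_ hD
      have hMγ : M ^ γ ≤ r ^ γ + τ ^ γ := by
        rcases le_total τ r with h' | h'
        · rw [hM, max_eq_left h']; linarith
        · rw [hM, max_eq_right h']; linarith
      have hrM : r ≤ M := le_max_left _ _
      have hτM : τ ≤ M := le_max_right _ _
      have hEM : E ≤ 4 * M ^ 2 := by
        rw [hE']
        have h2 := mul_nonneg (mul_nonneg hr.le hτ0)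
          (by linarith [Real.neg_one_le_cos φ] : 0 ≤ 1 + Real.cos φ)
        have h3 : (r + τ) ^ 2 ≤ (2 * M) ^ 2 := by gcongr; linarith
        linear_combination 2 * h2 + h3
      calc c₂ * (M ^ (γ - 1)) ^ 2 * E ≤ κ ^ 2 / 16 * (M ^ (γ - 1)) ^ 2 * (4 * M ^ 2) := by
            gcongr; exact min_le_right _ _
        _ = κ ^ 2 / 4 * (M ^ γ) ^ 2 := by rw [hpow M hM0.le]; ring
        _ ≤ _ := by gcongr
  have hMinv : M ^ (1 - γ) = (M ^ (γ - 1))⁻¹ := by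
    rw [← Real.rpow_neg hM0.le]; congr 1; ring
  have hMp : 0 < M ^ (γ - 1) := by positivity
  calc _ ≤ C₁ * M ^ (γ - 1) * (r * Real.sin φ) / (c₂ * (M ^ (γ - 1)) ^ 2 * E) := by
        gcongr
    _ = _ := by rw [hMinv]; field_simp

lemma lintegral_cauchy_affine {A k : ℝ} (hA : 0 < A) (hk : 0 < k) (d : ℝ) :
    ∫⁻ l : ℝ, ENNReal.ofReal (A / (A ^ 2 + (k * l - d) ^ 2)) = ENNReal.ofReal (Real.pi / k) := by
  obtain ⟨K, hK⟩ : ∃ K : NNReal, (K : ℝ) = A / k := ⟨Real.toNNReal (A / k),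
    Real.coe_toNNReal _ (by positivity)⟩
  have hAk : K ≠ 0 := by
    rw [← NNReal.coe_ne_zero, hK]; positivity
  have h := ProbabilityTheory.lintegral_cauchyPDF_eq_one (d / k) hAk
  have hpi := Real.pi_pos
  have heq : ∀ l : ℝ, ENNReal.ofReal (A / (A ^ 2 + (k * l - d) ^ 2)) =
      ENNReal.ofReal (Real.pi / k) * ProbabilityTheory.cauchyPDF (d / k) K l := by
    intro l
    rw [ProbabilityTheory.cauchyPDF_def, ProbabilityTheory.cauchyPDFReal_def,
      ← ENNReal.ofReal_mul (by positivity)]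
    congr 1
    rw [hK]
    have e : (l - d / k) ^ 2 + (A / k) ^ 2 = (A ^ 2 + (k * l - d) ^ 2) / k ^ 2 := by
      field_simp; ring
    rw [e]
    field_simp
  simp_rw [heq]
  rw [lintegral_const_mul _ (ProbabilityTheory.measurable_cauchyPDF _ _), h, mul_one]

lemma tail_lintegral_bound_and_tendsto {γ c C κ k d h : ℝ} (hγ : 1 < γ) (hC : 0 ≤ C) (hκ : 0 < κ)
    (hk : 0 < k) {f : ℝ → ℝ} (hf : Measurable f) (hf0 : ∀ t, 0 ≤ f t)
    (hfi : Integrable fun t : ℝ => f t * |t| ^ (-1 + 1 / γ))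
    (hfc : ∫ t : ℝ, f t * |t| ^ (-1 + 1 / γ) ≤ c) {G : ℝ → ℝ → ℝ}
    (hG : ∀ s l : ℝ, 0 < s → h * s ≤ l → ENNReal.ofReal (G s l) ≤
      ∫⁻ t : ℝ, ENNReal.ofReal (f t * (C * (max (κ * s) (|t| ^ (1 / γ))) ^ (1 - γ) *
        (κ * s / ((κ * s) ^ 2 + (k * l - d * s - |t| ^ (1 / γ)) ^ 2))))) :
    (∀ s : ℝ, 0 < s → ∫⁻ l in Ici (h * s), ENNReal.ofReal (G s l) ≤
      ENNReal.ofReal (C * (Real.pi / k) * c)) ∧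
    Tendsto (fun s : ℝ => ∫⁻ l in Ici (h * s), ENNReal.ofReal (G s l)) atTop (𝓝 0) := by
  have hpi := Real.pi_pos
  set J : ℝ → ℝ → ℝ≥0∞ := fun s t => ENNReal.ofReal
    (C * (Real.pi / k) * (f t * (max (κ * s) (|t| ^ (1 / γ))) ^ (1 - γ))) with hJ
  have hJm : ∀ s, Measurable (J s) := by
    intro s
    have := hf
    simp only [hJ]
    fun_prop
  have hbound : ∀ s : ℝ, 0 < s → ∫⁻ l in Ici (h * s), ENNReal.ofReal (G s l) ≤ ∫⁻ t, J s t := by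
    intro s hs
    have hκs : 0 < κ * s := by positivity
    set m : ℝ → ℝ := fun t => f t * (C * (max (κ * s) (|t| ^ (1 / γ))) ^ (1 - γ)) with hm
    have hm0 : ∀ t, 0 ≤ m t := by
      intro t
      have : 0 < max (κ * s) (|t| ^ (1 / γ)) := lt_max_of_lt_left hκs
      have := hf0 t
      positivity
    have hmm : Measurable m := by
      have := hf
      simp only [hm]
      fun_prop
    calc ∫⁻ l in Ici (h * s), ENNReal.ofReal (G s l)
        ≤ ∫⁻ l in Ici (h * s), ∫⁻ t : ℝ, ENNReal.ofReal (m t) * ENNReal.ofReal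
            (κ * s / ((κ * s) ^ 2 + (k * l - (d * s + |t| ^ (1 / γ))) ^ 2)) := by
          refine setLIntegral_mono' measurableSet_Ici fun l hl => ?_
          refine (hG s l hs hl).trans_eq ?_
          refine lintegral_congr fun t => ?_
          rw [← ENNReal.ofReal_mul (hm0 t), hm]
          ring_nf
      _ ≤ ∫⁻ l : ℝ, ∫⁻ t : ℝ, ENNReal.ofReal (m t) * ENNReal.ofReal
            (κ * s / ((κ * s) ^ 2 + (k * l - (d * s + |t| ^ (1 / γ))) ^ 2)) :=
          setLIntegral_le_lintegral _ _
      _ = ∫⁻ t : ℝ, ∫⁻ l : ℝ, ENNReal.ofReal (m t) * ENNReal.ofReal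
            (κ * s / ((κ * s) ^ 2 + (k * l - (d * s + |t| ^ (1 / γ))) ^ 2)) := by
          refine lintegral_lintegral_swap (Measurable.aemeasurable ?_)
          simp only [Function.uncurry_def]
          fun_prop
      _ = ∫⁻ t, J s t := by
          refine lintegral_congr fun t => ?_
          rw [lintegral_const_mul _ (by fun_prop), lintegral_cauchy_affine hκs hk,
            ← ENNReal.ofReal_mul (hm0 t)]
          simp only [hJ, hm]
          ring_nf
  have hdom : ∀ s : ℝ, 0 < s → ∀ᵐ t : ℝ, J s t ≤
      ENNReal.ofReal (C * (Real.pi / k) * (f t * |t| ^ (-1 + 1 / γ))) := by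
    intro s hs
    filter_upwards [Measure.ae_ne volume (0 : ℝ)] with t ht
    have ht' : 0 < |t| := abs_pos.2 ht
    refine ENNReal.ofReal_le_ofReal ?_
    have := hf0 t
    have h1 : (max (κ * s) (|t| ^ (1 / γ))) ^ (1 - γ) ≤ |t| ^ (-1 + 1 / γ) := by
      have h2 : |t| ^ (-1 + 1 / γ) = (|t| ^ (1 / γ)) ^ (1 - γ) := by
        rw [← Real.rpow_mul ht'.le]; congr 1; field_simp; ring
      rw [h2]
      exact Real.rpow_le_rpow_of_nonpos (by positivity) (le_max_right _ _) (by linarith)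
    gcongr
  have hfin : ∫⁻ t : ℝ, ENNReal.ofReal (C * (Real.pi / k) * (f t * |t| ^ (-1 + 1 / γ))) ≤
      ENNReal.ofReal (C * (Real.pi / k) * c) := by
    rw [← ofReal_integral_eq_lintegral_ofReal (hfi.const_mul _)
      (Eventually.of_forall fun t => by have := hf0 t; positivity), integral_const_mul]
    exact ENNReal.ofReal_le_ofReal (by gcongr)
  refine ⟨fun s hs => (hbound s hs).trans ((lintegral_mono_ae (hdom s hs)).trans hfin), ?_⟩
  have hJlim : Tendsto (fun s => ∫⁻ t, J s t) atTop (𝓝 (∫⁻ _ : ℝ, (0 : ℝ≥0∞))) := by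
    refine tendsto_lintegral_filter_of_dominated_convergence _
      (Eventually.of_forall hJm) ((eventually_gt_atTop 0).mono hdom)
      (ne_top_of_le_ne_top ENNReal.ofReal_ne_top hfin) (Eventually.of_forall fun t => ?_)
    have h1 : Tendsto (fun s : ℝ => max (κ * s) (|t| ^ (1 / γ))) atTop atTop :=
      tendsto_atTop_mono (fun s => le_max_left _ _) (tendsto_id.const_mul_atTop hκ)
    have h2 := (tendsto_rpow_neg_atTop (by linarith : 0 < γ - 1)).comp h1
    have h3 := (h2.const_mul (f t)).const_mul (C * (Real.pi / k))
    have h4 := ENNReal.tendsto_ofReal h3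
    simpa [hJ, Function.comp_def] using h4
  rw [lintegral_zero] at hJlim
  exact tendsto_of_tendsto_of_tendsto_of_le_of_le' tendsto_const_nhds hJlim
    (Eventually.of_forall fun _ => zero_le) ((eventually_gt_atTop 0).mono hbound)

lemma norm_mul_sin_arg_edge (a b : ℝ) :
    ‖((-a : ℝ) : ℂ) + (b : ℂ) * Complex.I‖ *
      Real.sin (Complex.arg (((-a : ℝ) : ℂ) + (b : ℂ) * Complex.I)) = b := by
  rw [Complex.norm_mul_sin_arg]; simp

lemma norm_mul_cos_arg_edge (a b : ℝ) :
    ‖((-a : ℝ) : ℂ) + (b : ℂ) * Complex.I‖ *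
      Real.cos (Complex.arg (((-a : ℝ) : ℂ) + (b : ℂ) * Complex.I)) = -a := by
  rw [Complex.norm_mul_cos_arg]; simp

lemma arg_pos_and_lt_pi_of_im_pos {z : ℂ} (hz : 0 < z.im) : 0 < z.arg ∧ z.arg < Real.pi := by
  refine ⟨lt_of_le_of_ne (Complex.arg_nonneg_iff.2 hz.le) fun h => ?_,
    Complex.arg_lt_pi_iff.2 (Or.inr hz.ne')⟩
  exact hz.ne' (Complex.arg_eq_zero_iff.1 h.symm).2

lemma norm_edge_pos (a : ℝ) {b : ℝ} (hb : 0 < b) :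
    0 < ‖((-a : ℝ) : ℂ) + (b : ℂ) * Complex.I‖ := by
  refine norm_pos_iff.2 fun h => hb.ne' ?_
  simpa using congrArg Complex.im h

lemma arg_edge_mem (a : ℝ) {b : ℝ} (hb : 0 < b) :
    0 < Complex.arg (((-a : ℝ) : ℂ) + (b : ℂ) * Complex.I) ∧
      Complex.arg (((-a : ℝ) : ℂ) + (b : ℂ) * Complex.I) < Real.pi :=
  arg_pos_and_lt_pi_of_im_pos (by simpa using hb)

lemma one_lt_gammaExp (a : ℝ) {b : ℝ} (hb : 0 < b) : 1 < gammaExp a b := by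
  obtain ⟨h0, h1⟩ := arg_edge_mem a hb
  rwa [gammaExp, lt_div_iff₀ h0, one_mul]

lemma norm_mul_sin_edge_sub (a b r φ : ℝ) :
    r * (‖((-a : ℝ) : ℂ) + (b : ℂ) * Complex.I‖ *
      Real.sin (Complex.arg (((-a : ℝ) : ℂ) + (b : ℂ) * Complex.I) - φ)) =
        b * (r * Real.cos φ) + a * (r * Real.sin φ) := by
  rw [Real.sin_sub]
  linear_combination r * Real.cos φ * norm_mul_sin_arg_edge a b -
    r * Real.sin φ * norm_mul_cos_arg_edge a b

lemma norm_mul_cos_edge_sub (a b r φ : ℝ) :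
    r * (‖((-a : ℝ) : ℂ) + (b : ℂ) * Complex.I‖ *
      Real.cos (Complex.arg (((-a : ℝ) : ℂ) + (b : ℂ) * Complex.I) - φ)) =
        -a * (r * Real.cos φ) + b * (r * Real.sin φ) := by
  rw [Real.cos_sub]
  linear_combination r * Real.cos φ * norm_mul_cos_arg_edge a b +
    r * Real.sin φ * norm_mul_sin_arg_edge a b

lemma norm_mul_sin_edge_sub_arg (a b : ℝ) (z : ℂ) :
    ‖z‖ * (‖((-a : ℝ) : ℂ) + (b : ℂ) * Complex.I‖ *
      Real.sin (Complex.arg (((-a : ℝ) : ℂ) + (b : ℂ) * Complex.I) - z.arg)) =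
        b * z.re + a * z.im := by
  rw [norm_mul_sin_edge_sub, Complex.norm_mul_sin_arg, Complex.norm_mul_cos_arg]

lemma norm_mul_cos_edge_sub_arg (a b : ℝ) (z : ℂ) :
    ‖z‖ * (‖((-a : ℝ) : ℂ) + (b : ℂ) * Complex.I‖ *
      Real.cos (Complex.arg (((-a : ℝ) : ℂ) + (b : ℂ) * Complex.I) - z.arg)) =
        -a * z.re + b * z.im := by
  rw [norm_mul_cos_edge_sub, Complex.norm_mul_sin_arg, Complex.norm_mul_cos_arg]

lemma arg_mem_of_mem_sectorS {a b : ℝ} (hb : 0 < b) {z : ℂ} (hz : z ∈ sectorS a b) :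
    0 < ‖z‖ ∧ 0 < z.arg ∧ z.arg < Complex.arg (((-a : ℝ) : ℂ) + (b : ℂ) * Complex.I) := by
  obtain ⟨h1, h2⟩ := hz
  obtain ⟨h3, h4⟩ := arg_pos_and_lt_pi_of_im_pos h1
  have hr : 0 < ‖z‖ := norm_pos_iff.2 fun h => by simp [h] at h1
  refine ⟨hr, h3, ?_⟩
  by_contra! hle
  have h5 := norm_mul_sin_edge_sub_arg a b z
  have h6 := Real.sin_nonpos_of_nonpos_of_neg_pi_le (sub_nonpos.2 hle)
    (by linarith [(arg_edge_mem a hb).1])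
  have h7 := mul_nonpos_of_nonneg_of_nonpos hr.le
    (mul_nonpos_of_nonneg_of_nonpos (norm_edge_pos a hb).le h6)
  linarith

lemma sectorS_subset_sectorS' (a b : ℝ) : sectorS a b ⊆ sectorS' a b := by
  have : 0 < Real.log 3 := Real.log_pos (by norm_num)
  exact fun z hz => ⟨by linarith [hz.1], by linarith [hz.2]⟩

lemma exists_sectorS_cpow_eq {a b : ℝ} (hb : 0 < b) {w : ℂ} (hw : 0 < w.im) :
    ∃ z ∈ sectorS a b, z ^ ((gammaExp a b : ℝ) : ℂ) = w := by
  have hγ := one_lt_gammaExp a hb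
  obtain ⟨hθ0, hθ⟩ := arg_edge_mem a hb
  obtain ⟨h0, hπ⟩ := arg_pos_and_lt_pi_of_im_pos hw
  have hr : 0 < ‖w‖ := norm_pos_iff.2 fun h => by simp [h] at hw
  have hpi := Real.pi_pos
  have hz := Complex.cpow_ofReal w (gammaExp a b)⁻¹
  set φ := w.arg * (gammaExp a b)⁻¹ with hφ
  set r := ‖w‖ ^ (gammaExp a b)⁻¹ with hrdef
  have hr0 : 0 < r := by positivity
  have hφ0 : 0 < φ := by positivity
  have hφθ : φ < Complex.arg (((-a : ℝ) : ℂ) + (b : ℂ) * Complex.I) := by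
    rw [hφ, gammaExp, inv_div, ← mul_div_assoc, div_lt_iff₀ hpi, mul_comm]
    gcongr
  have him : (w ^ (((gammaExp a b)⁻¹ : ℝ) : ℂ)).im = r * Real.sin φ := by
    rw [hz]; simp [-Complex.ofReal_sin]
  have hre : (w ^ (((gammaExp a b)⁻¹ : ℝ) : ℂ)).re = r * Real.cos φ := by
    rw [hz]; simp [-Complex.ofReal_cos]
  refine ⟨w ^ (((gammaExp a b)⁻¹ : ℝ) : ℂ), ⟨?_, ?_⟩, ?_⟩
  · rw [him]
    exact mul_pos hr0 (Real.sin_pos_of_pos_of_lt_pi hφ0 (by linarith))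
  · rw [him, hre, ← norm_mul_sin_edge_sub]
    exact mul_pos hr0 (mul_pos (norm_edge_pos a hb)
      (Real.sin_pos_of_pos_of_lt_pi (by linarith) (by linarith)))
  · have hlog : (Complex.log w * (((gammaExp a b)⁻¹ : ℝ) : ℂ)).im = φ := by
      rw [Complex.im_mul_ofReal, Complex.log_im]
    rw [← Complex.cpow_mul _ (by rw [hlog]; linarith) (by rw [hlog]; linarith),
      ← Complex.ofReal_mul, inv_mul_cancel₀ (by linarith), Complex.ofReal_one, Complex.cpow_one]

lemma boundary_nonneg {a b : ℝ} (hb : 0 < b) {H Ht : ℂ → ℝ} (hpos : ∀ z ∈ sectorS' a b, 0 < H z)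
    (hcont : ContinuousOn Ht {z : ℂ | 0 ≤ z.im})
    (hHt : ∀ ζ ∈ sectorS a b, Ht (ζ ^ ((gammaExp a b : ℝ) : ℂ)) = H ζ) (t : ℝ) :
    0 ≤ Ht (t : ℂ) := by
  have hp : Tendsto (fun V : ℝ => (t : ℂ) + (V : ℂ) * Complex.I) (𝓝[>] 0)
      (𝓝[{z : ℂ | 0 ≤ z.im}] (t : ℂ)) := by
    refine tendsto_nhdsWithin_iff.2 ⟨?_, ?_⟩
    · have : Continuous fun V : ℝ => (t : ℂ) + (V : ℂ) * Complex.I := by fun_prop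
      have h := this.tendsto 0
      simp only [Complex.ofReal_zero, zero_mul, add_zero] at h
      exact h.mono_left nhdsWithin_le_nhds
    · filter_upwards [self_mem_nhdsWithin] with V hV
      simpa using (le_of_lt hV : (0 : ℝ) ≤ V)
  have hlim := (hcont (t : ℂ) (by simp)).tendsto.comp hp
  refine ge_of_tendsto hlim ?_
  filter_upwards [self_mem_nhdsWithin] with V hV
  obtain ⟨z, hz, hzw⟩ := exists_sectorS_cpow_eq (a := a) hb
    (w := (t : ℂ) + (V : ℂ) * Complex.I) (by simpa using hV)
  rw [Function.comp_apply, ← hzw, hHt z hz]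
  exact (hpos z (sectorS_subset_sectorS' a b hz)).le

lemma ofReal_le_lintegral_poisson {a b : ℝ} (hb : 0 < b) {H Ht : ℂ → ℝ}
    (hHt : ∀ ζ ∈ sectorS a b, Ht (ζ ^ ((gammaExp a b : ℝ) : ℂ)) = H ζ)
    (hnn : ∀ t : ℝ, 0 ≤ Ht (t : ℂ))
    (hP : ∀ U V : ℝ, 0 < V → Ht ((U : ℂ) + (V : ℂ) * Complex.I) =
      (1 / Real.pi) * ∫ t : ℝ, Ht (t : ℂ) * (V / (V ^ 2 + (t - U) ^ 2)))
    {z : ℂ} (hz : z ∈ sectorS a b) {B : ℝ → ℝ}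
    (hB : ∀ t : ℝ, ‖z‖ ^ gammaExp a b * Real.sin (z.arg * gammaExp a b) /
      ((‖z‖ ^ gammaExp a b * Real.sin (z.arg * gammaExp a b)) ^ 2 +
        (t - ‖z‖ ^ gammaExp a b * Real.cos (z.arg * gammaExp a b)) ^ 2) ≤ B t) :
    ENNReal.ofReal (H z) ≤ ∫⁻ t : ℝ, ENNReal.ofReal (Ht (t : ℂ) * B t) := by
  obtain ⟨hr, h0, hθ⟩ := arg_mem_of_mem_sectorS hb hz
  obtain ⟨hθ0, hθπ⟩ := arg_edge_mem a hb
  have hγ := one_lt_gammaExp a hb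
  have hpi := Real.pi_pos
  have hψ : z.arg * gammaExp a b < Real.pi := by
    rw [gammaExp, ← mul_div_assoc, div_lt_iff₀ hθ0, mul_comm]
    gcongr
  have hV : 0 < ‖z‖ ^ gammaExp a b * Real.sin (z.arg * gammaExp a b) :=
    mul_pos (by positivity) (Real.sin_pos_of_pos_of_lt_pi (by positivity) hψ)
  set U := ‖z‖ ^ gammaExp a b * Real.cos (z.arg * gammaExp a b) with hUdef
  set V := ‖z‖ ^ gammaExp a b * Real.sin (z.arg * gammaExp a b) with hVdef
  have hzUV : z ^ ((gammaExp a b : ℝ) : ℂ) = (U : ℂ) + (V : ℂ) * Complex.I := by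
    rw [Complex.cpow_ofReal, hUdef, hVdef]; push_cast; ring
  have h_nonneg : 0 ≤ ∫ t : ℝ, Ht (t : ℂ) * (V / (V ^ 2 + (t - U) ^ 2)) :=
    integral_nonneg fun t => mul_nonneg (hnn t) (by positivity)
  have hle : H z ≤ ∫ t : ℝ, Ht (t : ℂ) * (V / (V ^ 2 + (t - U) ^ 2)) := by
    rw [← hHt z hz, hzUV, hP U V hV]
    refine mul_le_of_le_one_left h_nonneg ?_
    rw [div_le_one hpi]
    linarith [Real.pi_gt_three]
  calc ENNReal.ofReal (H z)
      ≤ ENNReal.ofReal (∫ t : ℝ, Ht (t : ℂ) * (V / (V ^ 2 + (t - U) ^ 2))) :=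
        ENNReal.ofReal_le_ofReal hle
    _ ≤ ‖∫ t : ℝ, Ht (t : ℂ) * (V / (V ^ 2 + (t - U) ^ 2))‖ₑ := by
        rw [Real.enorm_of_nonneg h_nonneg]
    _ ≤ ∫⁻ t : ℝ, ‖Ht (t : ℂ) * (V / (V ^ 2 + (t - U) ^ 2))‖ₑ :=
        enorm_integral_le_lintegral_enorm _
    _ ≤ _ := by
        refine lintegral_mono fun t => ?_
        rw [Real.enorm_of_nonneg (mul_nonneg (hnn t) (by positivity))]
        exact ENNReal.ofReal_le_ofReal (mul_le_mul_of_nonneg_left (hB t) (hnn t))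

lemma exists_poisson_sector_le {a b κ : ℝ} (hb : 0 < b) (hκ : 0 < κ) :
    ∃ C : ℝ, 0 < C ∧ ∀ z ∈ sectorS a b,
      κ * (‖z‖ * ‖((-a : ℝ) : ℂ) + (b : ℂ) * Complex.I‖) ≤ b * z.re + a * z.im → ∀ t : ℝ,
      ‖z‖ ^ gammaExp a b * Real.sin (z.arg * gammaExp a b) /
          ((‖z‖ ^ gammaExp a b * Real.sin (z.arg * gammaExp a b)) ^ 2 +
            (t - ‖z‖ ^ gammaExp a b * Real.cos (z.arg * gammaExp a b)) ^ 2) ≤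
        C * (max z.im (|t| ^ (1 / gammaExp a b))) ^ (1 - gammaExp a b) *
          (z.im / (z.im ^ 2 + (z.re - |t| ^ (1 / gammaExp a b)) ^ 2)) := by
  obtain ⟨hθ0, hθπ⟩ := arg_edge_mem a hb
  have hγ := one_lt_gammaExp a hb
  obtain ⟨C, hC, hCb⟩ := exists_poisson_rpow_le hθ0 hθπ hκ
  rw [← gammaExp] at hCb
  refine ⟨C, hC, fun z hz hzκ t => ?_⟩
  obtain ⟨hr, h0, hθ⟩ := arg_mem_of_mem_sectorS hb hz
  have hN := norm_edge_pos a hb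
  have hs := norm_mul_sin_edge_sub_arg a b z
  have h1 := hCb ‖z‖ z.arg t hr h0 hθ
    (le_of_mul_le_mul_right (by linarith) (mul_pos hr hN))
  rw [Complex.norm_mul_sin_arg, Complex.norm_mul_cos_arg] at h1
  refine h1.trans ?_
  have him : 0 < z.im := hz.1
  have h2 : (max ‖z‖ (|t| ^ (1 / gammaExp a b))) ^ (1 - gammaExp a b) ≤
      (max z.im (|t| ^ (1 / gammaExp a b))) ^ (1 - gammaExp a b) :=
    Real.rpow_le_rpow_of_nonpos (lt_max_of_lt_left him)
      (max_le_max_right _ ((le_abs_self _).trans (Complex.abs_im_le_norm z))) (by linarith)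
  gcongr

/-- The bound obtained from `exists_poisson_rpow_le` after reflecting the sector across its
bisector. -/
lemma exists_poisson_sector_le' {a b κ : ℝ} (hb : 0 < b) (hκ : 0 < κ) :
    ∃ C : ℝ, 0 < C ∧ ∀ z ∈ sectorS a b, κ * ‖z‖ ≤ z.im → ∀ t : ℝ, ∀ x y : ℝ,
      b * z.re + a * z.im = y * ‖((-a : ℝ) : ℂ) + (b : ℂ) * Complex.I‖ →
      -a * z.re + b * z.im = x * ‖((-a : ℝ) : ℂ) + (b : ℂ) * Complex.I‖ →
      ‖z‖ ^ gammaExp a b * Real.sin (z.arg * gammaExp a b) /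
          ((‖z‖ ^ gammaExp a b * Real.sin (z.arg * gammaExp a b)) ^ 2 +
            (t - ‖z‖ ^ gammaExp a b * Real.cos (z.arg * gammaExp a b)) ^ 2) ≤
        C * (max y (|t| ^ (1 / gammaExp a b))) ^ (1 - gammaExp a b) *
          (y / (y ^ 2 + (x - |t| ^ (1 / gammaExp a b)) ^ 2)) := by
  obtain ⟨hθ0, hθπ⟩ := arg_edge_mem a hb
  have hγ := one_lt_gammaExp a hb
  obtain ⟨C, hC, hCb⟩ := exists_poisson_rpow_le hθ0 hθπ hκ
  rw [← gammaExp] at hCb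
  refine ⟨C, hC, fun z hz hzκ t x y hy hx => ?_⟩
  obtain ⟨hr, h0, hθ⟩ := arg_mem_of_mem_sectorS hb hz
  have hN := norm_edge_pos a hb
  have hs := norm_mul_sin_edge_sub_arg a b z
  have hc := norm_mul_cos_edge_sub_arg a b z
  have him := Complex.norm_mul_sin_arg z
  have hsub : (Complex.arg (((-a : ℝ) : ℂ) + (b : ℂ) * Complex.I) - z.arg) * gammaExp a b =
      Real.pi - z.arg * gammaExp a b := by
    rw [sub_mul, gammaExp, mul_div_cancel₀ _ hθ0.ne']
  generalize Complex.arg (((-a : ℝ) : ℂ) + (b : ℂ) * Complex.I) = θ at *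
  generalize ‖((-a : ℝ) : ℂ) + (b : ℂ) * Complex.I‖ = N at *
  have h1 := hCb ‖z‖ (θ - z.arg) (-t) hr (by linarith) (by linarith)
    (by rw [sub_sub_cancel]; exact le_of_mul_le_mul_left (by linarith) hr)
  have hys : ‖z‖ * Real.sin (θ - z.arg) = y := by
    apply mul_right_cancel₀ hN.ne'; linarith
  have hxc : ‖z‖ * Real.cos (θ - z.arg) = x := by
    apply mul_right_cancel₀ hN.ne'; linarith
  have hyle : y ≤ ‖z‖ := by
    rw [← hys]; exact mul_le_of_le_one_right hr.le (Real.sin_le_one _)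
  have hy0 : 0 < y := pos_of_mul_pos_left (hy ▸ hz.2) hN.le
  rw [hys, hxc, abs_neg, hsub, Real.sin_pi_sub, Real.cos_pi_sub] at h1
  have hD : (-t - ‖z‖ ^ gammaExp a b * -Real.cos (z.arg * gammaExp a b)) ^ 2 =
      (t - ‖z‖ ^ gammaExp a b * Real.cos (z.arg * gammaExp a b)) ^ 2 := by ring
  rw [hD] at h1
  refine h1.trans ?_
  have h2 : (max ‖z‖ (|t| ^ (1 / gammaExp a b))) ^ (1 - gammaExp a b) ≤
      (max y (|t| ^ (1 / gammaExp a b))) ^ (1 - gammaExp a b) :=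
    Real.rpow_le_rpow_of_nonpos (lt_max_of_lt_left hy0)
      (max_le_max_right _ hyle) (by linarith)
  gcongr

/-- uniform bounds and decay of the integrals of a `c`-admissible positive
harmonic function along the tails of the half-lines `Λ_{1,s}` and `Λ_{2,s}`. -/
theorem stmt3 (a b : ℝ) (hb : 0 < b) (c h : ℝ) (hc : 0 < c) (hh : 0 < h) :
    ∃ ch : ℝ, 0 < ch ∧
      ∀ H : ℂ → ℝ, PosHarmonic a b H → Admissible a b c H →
        ((∀ s : ℝ, 0 < s →
          (∫⁻ l in Set.Ici (h * s), ENNReal.ofReal (H (lam1pt a b s l))) ≤ ENNReal.ofReal ch ∧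
          (∫⁻ l in Set.Ici (h * s), ENNReal.ofReal (H (lam2pt a b s l))) ≤ ENNReal.ofReal ch) ∧
        Tendsto (fun s : ℝ => ∫⁻ l in Set.Ici (h * s), ENNReal.ofReal (H (lam1pt a b s l)))
          atTop (𝓝 0) ∧
        Tendsto (fun s : ℝ => ∫⁻ l in Set.Ici (h * s), ENNReal.ofReal (H (lam2pt a b s l)))
          atTop (𝓝 0)) := by
  obtain ⟨N, hNdef⟩ : ∃ N, ‖((-a : ℝ) : ℂ) + (b : ℂ) * Complex.I‖ = N := ⟨_, rfl⟩
  have hN : 0 < N := hNdef ▸ norm_edge_pos a hb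
  have hN2 : N ^ 2 = a ^ 2 + b ^ 2 := by
    rw [← hNdef, Complex.sq_norm, Complex.normSq_apply]
    simp
    ring
  have hγ := one_lt_gammaExp a hb
  have hpi := Real.pi_pos
  have hs1 : ∀ s l, (lam1pt a b s l).re = l - a / b * s ∧ (lam1pt a b s l).im = s := by
    intro s l
    refine ⟨?_, ?_⟩
    · simp [lam1pt, etaC]
      field_simp
      ring
    · simp [lam1pt, etaC]
      field_simp
  have hs2 : ∀ s l, (lam2pt a b s l).re = s / b - a * l ∧ (lam2pt a b s l).im = b * l := by
    intro s l
    constructor <;> simp [lam2pt, etaC]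
  have hedge : -(starRingEnd ℂ (etaC a b)) = ((-a : ℝ) : ℂ) + (b : ℂ) * Complex.I := by
    simp [etaC]
    ring
  have hn1 : ∀ s l, 0 < s → h * s ≤ l → ‖lam1pt a b s l‖ ≤ (N / (b * h) + 1) * l := by
    intro s l hs hl
    have hl0 : 0 < l := lt_of_lt_of_le (by positivity) hl
    rw [lam1pt, hedge]
    refine (norm_add_le _ _).trans ?_
    rw [norm_mul, hNdef, Complex.norm_of_nonneg (by positivity), Complex.norm_of_nonneg hl0.le]
    have : s ≤ l / h := by rw [le_div_iff₀ hh]; linarith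
    calc N * (s / b) + l ≤ N * (l / h / b) + l := by gcongr
      _ = _ := by field_simp
  have hn2 : ∀ s l, 0 < s → h * s ≤ l → ‖lam2pt a b s l‖ ≤ (1 / (b * h) + N) * l := by
    intro s l hs hl
    have hl0 : 0 < l := lt_of_lt_of_le (by positivity) hl
    rw [lam2pt, sub_eq_add_neg, ← neg_mul, hedge]
    refine (norm_add_le _ _).trans ?_
    rw [norm_mul, hNdef, Complex.norm_of_nonneg (by positivity), Complex.norm_of_nonneg hl0.le]
    have : s ≤ l / h := by rw [le_div_iff₀ hh]; linarith
    calc s / b + N * l ≤ l / h / b + N * l := by gcongr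
      _ = _ := by field_simp
  obtain ⟨C₁, hC₁, hB₁⟩ := exists_poisson_sector_le (a := a)
    (κ := b / (N * (N / (b * h) + 1))) hb (by positivity)
  obtain ⟨C₂, hC₂, hB₂⟩ := exists_poisson_sector_le' (a := a)
    (κ := b / (1 / (b * h) + N)) hb (by positivity)
  rw [hNdef] at hB₁ hB₂
  refine ⟨C₁ * (Real.pi / 1) * c + C₂ * (Real.pi / N) * c, by positivity, ?_⟩
  rintro H ⟨hpos, -⟩ ⟨Ht, hcont, hHt, -, hfi, hfc, hP⟩
  have hnn := boundary_nonneg hb hpos hcont hHt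
  have hmeas : Measurable fun t : ℝ => Ht (t : ℂ) := by
    refine Continuous.measurable ?_
    exact hcont.comp_continuous Complex.continuous_ofReal fun t => by simp
  have key₁ := tail_lintegral_bound_and_tendsto (C := C₁) (κ := 1) (k := 1) (d := a / b) (h := h)
    (G := fun s l => H (lam1pt a b s l)) hγ hC₁.le one_pos one_pos hmeas hnn hfi hfc (by
      intro s l hs hl
      have hl0 : 0 < l := lt_of_lt_of_le (by positivity) hl
      obtain ⟨hre, him⟩ := hs1 s l
      have hbl : b * (lam1pt a b s l).re + a * (lam1pt a b s l).im = b * l := by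
        rw [hre, him]; field_simp; ring
      have hz : lam1pt a b s l ∈ sectorS a b := ⟨by rw [him]; exact hs, by rw [hbl]; positivity⟩
      refine ofReal_le_lintegral_poisson hb hHt hnn hP hz fun t => ?_
      have h1 := hB₁ _ hz (by
        rw [hbl]
        calc _ ≤ b / (N * (N / (b * h) + 1)) * ((N / (b * h) + 1) * l * N) := by
              gcongr; exact hn1 s l hs hl
          _ = b * l := by field_simp) t
      rw [hre, him] at h1
      simpa only [one_mul] using h1)
  have key₂ := tail_lintegral_bound_and_tendsto (C := C₂) (κ := 1 / N) (k := N) (d := a / (b * N))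
    (h := h) (G := fun s l => H (lam2pt a b s l)) hγ hC₂.le (by positivity) hN hmeas hnn hfi hfc (by
      intro s l hs hl
      have hl0 : 0 < l := lt_of_lt_of_le (by positivity) hl
      obtain ⟨hre, him⟩ := hs2 s l
      have hbs : b * (lam2pt a b s l).re + a * (lam2pt a b s l).im = s := by
        rw [hre, him]; field_simp; ring
      have hz : lam2pt a b s l ∈ sectorS a b := ⟨by rw [him]; positivity, by rw [hbs]; exact hs⟩
      refine ofReal_le_lintegral_poisson hb hHt hnn hP hz fun t => ?_
      refine hB₂ _ hz ?_ t _ _ ?_ ?_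
      · rw [him]
        calc _ ≤ b / (1 / (b * h) + N) * ((1 / (b * h) + N) * l) := by
              gcongr; exact hn2 s l hs hl
          _ = b * l := by field_simp
      · rw [hbs]; field_simp
      · rw [hre, him, sub_mul, mul_right_comm N, ← sq, hN2]; field_simp; ring)
  have hx₁ : 0 ≤ C₁ * (Real.pi / 1) * c := by positivity
  have hx₂ : 0 ≤ C₂ * (Real.pi / N) * c := by positivity
  exact ⟨fun s hs => ⟨(key₁.1 s hs).trans (ENNReal.ofReal_le_ofReal (by linarith)),
    (key₂.1 s hs).trans (ENNReal.ofReal_le_ofReal (by linarith))⟩, key₁.2, key₂.2⟩
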